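/- Let 0 < α < 1. There exists a constant c > 0 (depending only on α) such that for every f in the Hölder class Λ_α(ℝ²) and all bounded normal operators N₁, N₂ on a complex Hilbert space H with N₁ − N₂ of trace class S₁, the singular values of f(N₁) − f(N₂) satisfy s_j(f(N₁) − f(N₂)) ≤ c · ‖f‖_{Λ_α} · (1+j)^{-α} · ‖N₁ − N₂‖_{S₁}^α for all j ≥ 0; in particular f(N₁) − f(N₂) belongs to the weak Schatten class S_{1/α,∞}. -/

import Mathlib

/-- The `j`-th singular value (approximation number) of a bounded operator `T`:
the distance from `T` to the operators of rank at most `j`. -/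
noncomputable def sNum {H : Type*} [NormedAddCommGroup H] [InnerProductSpace ℂ H]
    (T : H →L[ℂ] H) (j : ℕ) : ℝ :=
  sInf {c : ℝ | ∃ R : H →L[ℂ] H, LinearMap.rank (R : H →ₗ[ℂ] H) ≤ j ∧ c = ‖T - R‖}

/-- `T` is of trace class `S₁`. -/
def MemTraceClass {H : Type*} [NormedAddCommGroup H] [InnerProductSpace ℂ H]
    (T : H →L[ℂ] H) : Prop :=
  Summable fun j : ℕ => sNum T j

section TraceNorm

open scoped InnerProductSpace

variable {H : Type*} [NormedAddCommGroup H] [InnerProductSpace ℂ H]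

/-- A finite family satisfying Bessel's inequality. -/
def IsBesselFamily {n : ℕ} (e : Fin n → H) : Prop :=
  ∀ x, ∑ i, ‖⟪e i, x⟫_ℂ‖ ^ 2 ≤ ‖x‖ ^ 2

/-- The trace norm of `T`, defined by duality against pairs of Bessel families, is at most `C`. -/
def TraceNormLE (T : H →L[ℂ] H) (C : ℝ) : Prop :=
  ∀ (n : ℕ) (e f : Fin n → H), IsBesselFamily e → IsBesselFamily f →
    ∑ i, ‖⟪f i, T (e i)⟫_ℂ‖ ≤ C

lemma Orthonormal.isBesselFamily {n : ℕ} {e : Fin n → H} (he : Orthonormal ℂ e) :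
    IsBesselFamily e := fun _ => he.sum_inner_products_le _

lemma IsBesselFamily.norm_le_one {n : ℕ} {e : Fin n → H} (he : IsBesselFamily e) (i : Fin n) :
    ‖e i‖ ≤ 1 := by
  have h1 : ‖⟪e i, e i⟫_ℂ‖ ^ 2 ≤ ‖e i‖ ^ 2 :=
    (Finset.single_le_sum (f := fun j => ‖⟪e j, e i⟫_ℂ‖ ^ 2) (fun _ _ => by positivity)
      (Finset.mem_univ i)).trans (he (e i))
  rw [inner_self_eq_norm_sq_to_K] at h1
  simp only [Complex.coe_algebraMap, norm_pow, Complex.norm_real, norm_norm] at h1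
  by_contra! h
  nlinarith [mul_pos (sub_pos.2 h) (sub_pos.2 h), sq_nonneg (‖e i‖ ^ 2 - ‖e i‖),
    mul_pos (mul_pos (sub_pos.2 h) (sub_pos.2 h)) (sub_pos.2 h), pow_pos (one_pos.trans h) 2]

namespace TraceNormLE

variable {S T : H →L[ℂ] H} {C C' : ℝ}

lemma nonneg (h : TraceNormLE T C) : 0 ≤ C := by
  simpa using h 0 0 0 (fun x => by simp) (fun x => by simp)

lemma mono (h : TraceNormLE T C) (hC : C ≤ C') : TraceNormLE T C' :=
  fun n e f he hf => (h n e f he hf).trans hC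

lemma zero : TraceNormLE (0 : H →L[ℂ] H) 0 := fun n e f _ _ => by simp

lemma add (hS : TraceNormLE S C) (hT : TraceNormLE T C') : TraceNormLE (S + T) (C + C') := by
  intro n e f he hf
  refine le_trans ?_ (add_le_add (hS n e f he hf) (hT n e f he hf))
  rw [← Finset.sum_add_distrib]
  refine Finset.sum_le_sum fun i _ => ?_
  rw [add_apply, inner_add_right]
  exact norm_add_le _ _

lemma smul (hT : TraceNormLE T C) (a : ℂ) : TraceNormLE (a • T) (‖a‖ * C) := by
  intro n e f he hf
  refine le_trans (le_of_eq ?_) (mul_le_mul_of_nonneg_left (hT n e f he hf) (norm_nonneg a))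
  simp [Finset.mul_sum]

lemma sum {ι : Type*} (s : Finset ι) {T : ι → H →L[ℂ] H} {C : ι → ℝ}
    (h : ∀ i ∈ s, TraceNormLE (T i) (C i)) : TraceNormLE (∑ i ∈ s, T i) (∑ i ∈ s, C i) := by
  classical
  induction s using Finset.induction_on with
  | empty => simpa using zero
  | insert a s ha ih =>
    rw [Finset.sum_insert ha, Finset.sum_insert ha]
    exact (h a (by simp)).add (ih fun i hi => h i (by simp [hi]))

lemma integral {X : Type*} [MeasurableSpace X] {μ : MeasureTheory.Measure X} [CompleteSpace H]
    {T : X → H →L[ℂ] H} {C : X → ℝ} (hT : MeasureTheory.Integrable T μ)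
    (hC : MeasureTheory.Integrable C μ) (h : ∀ x, TraceNormLE (T x) (C x)) :
    TraceNormLE (∫ x, T x ∂μ) (∫ x, C x ∂μ) := by
  intro n e f he hf
  have hint : ∀ i, MeasureTheory.Integrable (fun x => ⟪f i, T x (e i)⟫_ℂ) μ := fun i =>
    ((innerSL ℂ (f i)).comp (ContinuousLinearMap.apply ℂ H (e i))).integrable_comp hT
  have heq : ∀ i, ⟪f i, (∫ x, T x ∂μ) (e i)⟫_ℂ = ∫ x, ⟪f i, T x (e i)⟫_ℂ ∂μ := fun i =>
    (((innerSL ℂ (f i)).comp (ContinuousLinearMap.apply ℂ H (e i))).integral_comp_comm hT).symm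
  calc ∑ i, ‖⟪f i, (∫ x, T x ∂μ) (e i)⟫_ℂ‖
      ≤ ∑ i, ∫ x, ‖⟪f i, T x (e i)⟫_ℂ‖ ∂μ :=
        Finset.sum_le_sum fun i _ => by
          rw [heq]; exact MeasureTheory.norm_integral_le_integral_norm _
    _ = ∫ x, ∑ i, ‖⟪f i, T x (e i)⟫_ℂ‖ ∂μ :=
        (MeasureTheory.integral_finsetSum _ fun i _ => (hint i).norm).symm
    _ ≤ ∫ x, C x ∂μ :=
        MeasureTheory.integral_mono (MeasureTheory.integrable_finsetSum _ fun i _ => (hint i).norm)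
          hC fun x => h x n e f he hf

variable [CompleteSpace H]

lemma adjoint (h : TraceNormLE T C) : TraceNormLE (star T) C := by
  intro n e f he hf
  refine le_trans (le_of_eq ?_) (h n f e hf he)
  refine Finset.sum_congr rfl fun i _ => ?_
  rw [ContinuousLinearMap.star_eq_adjoint, ContinuousLinearMap.adjoint_inner_right,
    norm_inner_symm]

lemma contraction_mul_mul (h : TraceNormLE T C) {A B : H →L[ℂ] H} (hA : ‖A‖ ≤ 1)
    (hB : ‖B‖ ≤ 1) : TraceNormLE (A * T * B) C := by
  have key : ∀ {A : H →L[ℂ] H}, ‖A‖ ≤ 1 → ∀ {n : ℕ} {e : Fin n → H}, IsBesselFamily e →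
      IsBesselFamily fun i => A (e i) := by
    intro A hA n e he x
    simp_rw [← ContinuousLinearMap.adjoint_inner_right]
    refine (he _).trans ?_
    gcongr
    refine (ContinuousLinearMap.le_opNorm _ _).trans ?_
    rw [LinearIsometryEquiv.norm_map]
    exact mul_le_of_le_one_left (norm_nonneg _) hA
  intro n e f he hf
  have hA' : ‖ContinuousLinearMap.adjoint A‖ ≤ 1 := by rwa [LinearIsometryEquiv.norm_map]
  refine le_trans (le_of_eq ?_) (h n _ _ (key hB he) (key hA' hf))
  refine Finset.sum_congr rfl fun i _ => ?_
  rw [ContinuousLinearMap.adjoint_inner_left]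
  rfl

lemma mul_mul (h : TraceNormLE T C) {A B : H →L[ℂ] H} {a b : ℝ} (hA : ‖A‖ ≤ a)
    (hB : ‖B‖ ≤ b) : TraceNormLE (A * T * B) (a * b * C) := by
  have key : ∀ {A : H →L[ℂ] H} {a : ℝ}, ‖A‖ ≤ a →
      ∃ A' : H →L[ℂ] H, ‖A'‖ ≤ 1 ∧ A = (a : ℂ) • A' := by
    intro A a hA
    rcases ((norm_nonneg A).trans hA).eq_or_lt with rfl | ha
    · exact ⟨0, by simp, by simpa using hA⟩
    · refine ⟨((a : ℂ)⁻¹) • A, ?_, ?_⟩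
      · rw [norm_smul, norm_inv, Complex.norm_real, Real.norm_of_nonneg ha.le]
        exact inv_mul_le_one_of_le₀ hA ha.le
      · rw [smul_inv_smul₀ (by exact_mod_cast ha.ne')]
  have ha := (norm_nonneg A).trans hA
  have hb := (norm_nonneg B).trans hB
  obtain ⟨A', hA', rfl⟩ := key hA
  obtain ⟨B', hB', rfl⟩ := key hB
  have := (h.contraction_mul_mul hA' hB').smul ((a : ℂ) * b)
  rw [norm_mul, Complex.norm_real, Complex.norm_real, Real.norm_of_nonneg ha,
    Real.norm_of_nonneg hb] at this
  convert this using 1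
  rw [smul_mul_assoc, smul_mul_assoc, mul_smul_comm, smul_smul]

lemma mul_left (h : TraceNormLE T C) {A : H →L[ℂ] H} {a : ℝ} (hA : ‖A‖ ≤ a) :
    TraceNormLE (A * T) (a * C) := by
  simpa using h.mul_mul hA (B := 1) (b := 1) ContinuousLinearMap.norm_id_le

end TraceNormLE

end TraceNorm

section SingularValues

open scoped InnerProductSpace

variable {H : Type*} [NormedAddCommGroup H] [InnerProductSpace ℂ H]

lemma sNum_bddBelow (T : H →L[ℂ] H) (j : ℕ) :
    BddBelow {c : ℝ | ∃ R : H →L[ℂ] H, LinearMap.rank (R : H →ₗ[ℂ] H) ≤ j ∧ c = ‖T - R‖} :=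
  ⟨0, by rintro _ ⟨R, -, rfl⟩; exact norm_nonneg _⟩

lemma sNum_nonempty (T : H →L[ℂ] H) (j : ℕ) :
    {c : ℝ | ∃ R : H →L[ℂ] H, LinearMap.rank (R : H →ₗ[ℂ] H) ≤ j ∧ c = ‖T - R‖}.Nonempty :=
  ⟨_, 0, by simp, rfl⟩

lemma sNum_le_norm_sub (T : H →L[ℂ] H) {R : H →L[ℂ] H} {j : ℕ}
    (hR : LinearMap.rank (R : H →ₗ[ℂ] H) ≤ j) : sNum T j ≤ ‖T - R‖ :=
  csInf_le (sNum_bddBelow T j) ⟨R, hR, rfl⟩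

lemma sNum_nonneg (T : H →L[ℂ] H) (j : ℕ) : 0 ≤ sNum T j :=
  le_csInf (sNum_nonempty T j) (by rintro _ ⟨R, -, rfl⟩; exact norm_nonneg _)

lemma exists_rank_le_norm_sub_lt (T : H →L[ℂ] H) {j : ℕ} {c : ℝ} (hc : sNum T j < c) :
    ∃ R : H →L[ℂ] H, LinearMap.rank (R : H →ₗ[ℂ] H) ≤ j ∧ ‖T - R‖ < c := by
  obtain ⟨_, ⟨R, hR, rfl⟩, h⟩ := exists_lt_of_csInf_lt (sNum_nonempty T j) hc
  exact ⟨R, hR, h⟩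

lemma sNum_antitone (T : H →L[ℂ] H) : Antitone (sNum T) := by
  intro i j hij
  refine le_csInf (sNum_nonempty T i) ?_
  rintro _ ⟨R, hR, rfl⟩
  exact sNum_le_norm_sub T (hR.trans (by exact_mod_cast hij))

lemma sNum_add_le (S T : H →L[ℂ] H) (j : ℕ) : sNum (S + T) j ≤ ‖S‖ + sNum T j := by
  rw [← sub_le_iff_le_add']
  refine le_csInf (sNum_nonempty T j) ?_
  rintro _ ⟨R, hR, rfl⟩
  rw [sub_le_iff_le_add']
  refine (sNum_le_norm_sub _ hR).trans ?_
  rw [add_sub_assoc]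
  exact norm_add_le _ _

instance {n : ℕ} (e : Fin n → H) : FiniteDimensional ℂ (Submodule.span ℂ (Set.range e)) :=
  FiniteDimensional.span_of_finite ℂ (Set.finite_range e)

lemma rank_starProjection_span_le {n : ℕ} (e : Fin n → H) :
    LinearMap.rank ((Submodule.span ℂ (Set.range e)).starProjection : H →ₗ[ℂ] H) ≤ n := by
  have h : LinearMap.range ((Submodule.span ℂ (Set.range e)).starProjection : H →ₗ[ℂ] H) =
      Submodule.span ℂ (Set.range e) := Submodule.range_starProjection _
  rw [LinearMap.rank, h]
  rw [← Module.finrank_eq_rank]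
  exact_mod_cast (finrank_range_le_card e).trans_eq (Fintype.card_fin n)

lemma exists_orthonormal_inner_of_lt_sNum [CompleteSpace H] (T : H →L[ℂ] H) {j : ℕ} {c : ℝ}
    (hc0 : 0 ≤ c) (hc : c < sNum T (2 * j)) (i : ℕ) (hi : i ≤ j + 1) :
    ∃ e f : Fin i → H, Orthonormal ℂ e ∧ Orthonormal ℂ f ∧ ∀ l, c ≤ ‖⟪f l, T (e l)⟫_ℂ‖ := by
  induction i with
  | zero => exact ⟨0, 0, by simp, by simp, fun l => l.elim0⟩
  | succ i ih =>
    obtain ⟨e, f, he, hf, hef⟩ := ih (by omega)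
    set P := (Submodule.span ℂ (Set.range e)).starProjection with hP
    set Q := (Submodule.span ℂ (Set.range f)).starProjection with hQ
    set R : H →L[ℂ] H := Q.comp T + ((1 - Q).comp T).comp P with hR
    have hrank : LinearMap.rank (R : H →ₗ[ℂ] H) ≤ (2 * j : ℕ) := by
      have h1 : LinearMap.rank ((Q.comp T : H →L[ℂ] H) : H →ₗ[ℂ] H) ≤ i :=
        (LinearMap.rank_comp_le_left (T : H →ₗ[ℂ] H) (Q : H →ₗ[ℂ] H)).trans
          (rank_starProjection_span_le f)
      have h2 : LinearMap.rank ((((1 - Q).comp T).comp P : H →L[ℂ] H) : H →ₗ[ℂ] H) ≤ i :=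
        (LinearMap.rank_comp_le_right (P : H →ₗ[ℂ] H) (((1 - Q).comp T : H →L[ℂ] H) : H →ₗ[ℂ] H)).trans
          (rank_starProjection_span_le e)
      refine (LinearMap.rank_add_le _ _).trans ((add_le_add h1 h2).trans ?_)
      norm_cast
      omega
    have hlt : c < ‖T - R‖ := hc.trans_le (sNum_le_norm_sub T hrank)
    obtain ⟨x, hx⟩ : ∃ x, c * ‖x‖ < ‖(T - R) x‖ := by
      by_contra! h
      exact hlt.not_ge (ContinuousLinearMap.opNorm_le_bound _ hc0 h)
    set u := x - P x with hu
    set v := T u - Q (T u) with hv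
    have hRv : (T - R) x = v := by
      simp only [hR, hv, hu, sub_apply, add_apply,
        ContinuousLinearMap.comp_apply, one_apply_eq_self, map_sub]
      abel
    rw [hRv] at hx
    have hux : ‖u‖ ≤ ‖x‖ := by
      have : u = (Submodule.span ℂ (Set.range e))ᗮ.starProjection x := by
        rw [Submodule.starProjection_orthogonal_val]
      rw [this]
      exact Submodule.norm_starProjection_apply_le _ _
    have hv0 : 0 < ‖v‖ := lt_of_le_of_lt (by positivity) hx
    have hu0 : 0 < ‖u‖ := by
      rw [norm_pos_iff]
      intro h0
      rw [hv, h0] at hv0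
      simp at hv0
    have hcu : c ≤ ‖v‖ / ‖u‖ := by
      rw [le_div_iff₀ hu0]
      exact (mul_le_mul_of_nonneg_left hux hc0).trans hx.le
    have hvT : ⟪v, T u⟫_ℂ = ⟪v, v⟫_ℂ := by
      conv_rhs => rw [hv]
      rw [inner_sub_right, ← hv, hv, Submodule.starProjection_inner_eq_zero _ _
        (Submodule.starProjection_apply_mem _ _), sub_zero]
    refine ⟨Matrix.vecCons (((‖u‖ : ℂ)⁻¹) • u) e, Matrix.vecCons (((‖v‖ : ℂ)⁻¹) • v) f, ?_, ?_, ?_⟩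
    · rw [orthonormal_vecCons_iff]
      refine ⟨?_, fun k => ?_, he⟩
      · simp [norm_smul, hu0.ne']
      · rw [inner_smul_left, hu, Submodule.starProjection_inner_eq_zero _ _
          (Submodule.subset_span (Set.mem_range_self k)), mul_zero]
    · rw [orthonormal_vecCons_iff]
      refine ⟨?_, fun k => ?_, hf⟩
      · simp [norm_smul, hv0.ne']
      · rw [inner_smul_left, hv, Submodule.starProjection_inner_eq_zero _ _
          (Submodule.subset_span (Set.mem_range_self k)), mul_zero]
    · refine Fin.cases ?_ (fun k => ?_)
      · simp only [Matrix.cons_val_zero, map_smul, inner_smul_left, inner_smul_right, hvT,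
          inner_self_eq_norm_sq_to_K]
        refine hcu.trans (le_of_eq ?_)
        simp
        field_simp
      · simpa using hef k

lemma TraceNormLE.sNum_le [CompleteSpace H] {T : H →L[ℂ] H} {C : ℝ} (h : TraceNormLE T C) (j : ℕ) :
    sNum T (2 * j) ≤ C / (j + 1) := by
  have hj : (0 : ℝ) < j + 1 := by positivity
  refine le_of_forall_lt_imp_le_of_dense fun c hc => ?_
  rcases le_total c 0 with hc0 | hc0
  · exact hc0.trans (div_nonneg h.nonneg hj.le)
  obtain ⟨e, f, he, hf, hef⟩ := exists_orthonormal_inner_of_lt_sNum T hc0 hc (j + 1) le_rfl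
  rw [le_div_iff₀ hj]
  refine le_trans ?_ (h _ e f he.isBesselFamily hf.isBesselFamily)
  refine le_trans (le_of_eq ?_) (Finset.sum_le_sum fun i _ => hef i)
  simp [mul_comm]

end SingularValues

section TraceClass

open scoped InnerProductSpace

variable {H : Type*} [NormedAddCommGroup H] [InnerProductSpace ℂ H]

lemma IsBesselFamily.sum_norm_inner_mul_le {n : ℕ} {e f : Fin n → H} (he : IsBesselFamily e)
    (hf : IsBesselFamily f) (x y : H) :
    ∑ i, ‖⟪e i, x⟫_ℂ‖ * ‖⟪f i, y⟫_ℂ‖ ≤ ‖x‖ * ‖y‖ := by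
  refine (Real.sum_mul_le_sqrt_mul_sqrt _ _ _).trans ?_
  gcongr
  · exact Real.sqrt_le_iff.2 ⟨norm_nonneg x, he x⟩
  · exact Real.sqrt_le_iff.2 ⟨norm_nonneg y, hf y⟩

variable [CompleteSpace H]

lemma TraceNormLE.of_rank_le {R : H →L[ℂ] H} {r : ℕ}
    (hR : LinearMap.rank (R : H →ₗ[ℂ] H) ≤ r) : TraceNormLE R (r * ‖R‖) := by
  intro n e f he hf
  have hfin : FiniteDimensional ℂ (LinearMap.range (R : H →ₗ[ℂ] H)) :=
    Module.rank_lt_aleph0_iff.1 (hR.trans_lt (Cardinal.natCast_lt_aleph0))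
  set b := stdOrthonormalBasis ℂ (LinearMap.range (R : H →ₗ[ℂ] H)) with hb
  have hcard : Module.finrank ℂ (LinearMap.range (R : H →ₗ[ℂ] H)) ≤ r := by
    rw [LinearMap.rank, ← Module.finrank_eq_rank] at hR
    exact_mod_cast hR
  have hexp : ∀ i, ⟪f i, R (e i)⟫_ℂ =
      ∑ k, ⟪(b k : H), R (e i)⟫_ℂ * ⟪f i, (b k : H)⟫_ℂ := by
    intro i
    have h1 := b.sum_repr' ⟨R (e i), LinearMap.mem_range_self (R : H →ₗ[ℂ] H) (e i)⟩
    have h2 := congrArg (fun x : LinearMap.range (R : H →ₗ[ℂ] H) => ⟪f i, (x : H)⟫_ℂ) h1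
    simp only [Submodule.coe_sum, Submodule.coe_smul, inner_sum, inner_smul_right,
      Submodule.coe_inner] at h2
    exact h2.symm
  have hbn : ∀ k, ‖(b k : H)‖ = 1 := fun k => b.orthonormal.1 k
  calc ∑ i, ‖⟪f i, R (e i)⟫_ℂ‖
      ≤ ∑ i, ∑ k, ‖⟪e i, star R (b k : H)⟫_ℂ‖ * ‖⟪f i, (b k : H)⟫_ℂ‖ := by
        refine Finset.sum_le_sum fun i _ => ?_
        rw [hexp]
        refine (norm_sum_le _ _).trans (le_of_eq (Finset.sum_congr rfl fun k _ => ?_))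
        rw [norm_mul, ContinuousLinearMap.star_eq_adjoint, ContinuousLinearMap.adjoint_inner_right,
          norm_inner_symm]
    _ = ∑ k, ∑ i, ‖⟪e i, star R (b k : H)⟫_ℂ‖ * ‖⟪f i, (b k : H)⟫_ℂ‖ := Finset.sum_comm
    _ ≤ ∑ k : Fin (Module.finrank ℂ (LinearMap.range (R : H →ₗ[ℂ] H))), ‖R‖ := by
        refine Finset.sum_le_sum fun k _ => (he.sum_norm_inner_mul_le hf _ _).trans ?_
        rw [hbn, mul_one]
        refine (ContinuousLinearMap.le_opNorm _ _).trans ?_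
        rw [hbn, mul_one, norm_star]
    _ ≤ r * ‖R‖ := by
        rw [Finset.sum_const, nsmul_eq_mul, Finset.card_univ, Fintype.card_fin]
        gcongr

lemma sum_two_pow_mul_le_of_antitone {t : ℕ → ℝ} (ht : Antitone t) (ht0 : ∀ m, 0 ≤ t m) (K : ℕ) :
    ∑ k ∈ Finset.range K, 2 ^ k * t (2 ^ k - 1) ≤ 2 * ∑ m ∈ Finset.range (2 ^ K - 1), t m := by
  suffices h : ∀ K, ∑ k ∈ Finset.range (K + 1), 2 ^ k * t (2 ^ k - 1) ≤
      2 * ∑ m ∈ Finset.range (2 ^ K), t m by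
    rcases K with _ | K
    · simp
    refine (h K).trans ?_
    gcongr
    · exact fun _ _ _ => ht0 _
    · have := Nat.one_le_two_pow (n := K)
      rw [pow_succ]; omega
  intro K
  induction K with
  | zero =>
    have := ht0 0
    simp
    linarith
  | succ K ih =>
    rw [Finset.sum_range_succ]
    have h1 : ∑ m ∈ Finset.range (2 ^ (K + 1)), t m =
        ∑ m ∈ Finset.range (2 ^ K), t m + ∑ m ∈ Finset.range (2 ^ K), t (2 ^ K + m) := by
      rw [pow_succ, mul_two, Finset.sum_range_add]
    have h2 : (2 ^ K : ℝ) * t (2 ^ (K + 1) - 1) ≤ ∑ m ∈ Finset.range (2 ^ K), t (2 ^ K + m) := by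
      have := Finset.card_nsmul_le_sum (Finset.range (2 ^ K)) (fun m => t (2 ^ K + m))
        (t (2 ^ (K + 1) - 1)) (fun m hm => ht (by
          have := Finset.mem_range.1 hm
          rw [pow_succ]; omega))
      simpa using this
    rw [h1, mul_add, pow_succ, mul_comm ((2 : ℝ) ^ K) 2, mul_assoc]
    gcongr

lemma TraceNormLE.of_approx {T : H →L[ℂ] H} {t : ℕ → ℝ} (ht : Antitone t) (hsum : Summable t)
    {R : ℕ → H →L[ℂ] H} (hR : ∀ m, LinearMap.rank (R m : H →ₗ[ℂ] H) ≤ m)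
    (hTR : ∀ m, ‖T - R m‖ ≤ t m) : TraceNormLE T (12 * ∑' m, t m) := by
  have ht0 : ∀ m, 0 ≤ t m := fun m => (norm_nonneg _).trans (hTR m)
  intro n e f he hf
  have hdiff : ∀ k, TraceNormLE (R (2 ^ (k + 1) - 1) - R (2 ^ k - 1))
      (6 * (2 ^ k * t (2 ^ k - 1))) := by
    intro k
    have hk := Nat.one_le_two_pow (n := k)
    have hr : LinearMap.rank ((R (2 ^ (k + 1) - 1) - R (2 ^ k - 1) : H →L[ℂ] H) : H →ₗ[ℂ] H) ≤
        (3 * 2 ^ k : ℕ) := by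
      have hneg : LinearMap.rank ((-R (2 ^ k - 1) : H →L[ℂ] H) : H →ₗ[ℂ] H) ≤
          (2 ^ k - 1 : ℕ) := by
        refine le_trans ?_ (hR _)
        have heq : ((-R (2 ^ k - 1) : H →L[ℂ] H) : H →ₗ[ℂ] H) =
            (-LinearMap.id) ∘ₗ (R (2 ^ k - 1) : H →ₗ[ℂ] H) := LinearMap.ext fun _ => rfl
        rw [heq]
        exact LinearMap.rank_comp_le_right _ _
      rw [sub_eq_add_neg]
      refine (LinearMap.rank_add_le _ _).trans ((add_le_add (hR _) hneg).trans ?_)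
      norm_cast
      rw [pow_succ]; omega
    refine (TraceNormLE.of_rank_le hr).mono ?_
    have hn : ‖R (2 ^ (k + 1) - 1) - R (2 ^ k - 1)‖ ≤ 2 * t (2 ^ k - 1) := by
      have h1 := hTR (2 ^ (k + 1) - 1)
      have h2 := hTR (2 ^ k - 1)
      have h3 : t (2 ^ (k + 1) - 1) ≤ t (2 ^ k - 1) := ht (by rw [pow_succ]; omega)
      have h4 : R (2 ^ (k + 1) - 1) - R (2 ^ k - 1) =
        (T - R (2 ^ k - 1)) - (T - R (2 ^ (k + 1) - 1)) := by abel
      rw [h4]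
      exact (norm_sub_le _ _).trans (by linarith)
    push_cast
    nlinarith [mul_le_mul_of_nonneg_left hn (show (0 : ℝ) ≤ 3 * 2 ^ k by positivity)]
  have hR0 : R 0 = 0 := by
    have := hR 0
    rw [Nat.cast_zero, nonpos_iff_eq_zero, LinearMap.rank, Submodule.rank_eq_zero,
      LinearMap.range_eq_bot] at this
    exact ContinuousLinearMap.coe_injective this
  have hK : ∀ K, ∑ i, ‖⟪f i, T (e i)⟫_ℂ‖ ≤ n * t (2 ^ K - 1) + 12 * ∑' m, t m := by
    intro K
    have h1 : TraceNormLE (R (2 ^ K - 1)) (12 * ∑' m, t m) := by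
      have h2 := TraceNormLE.sum (Finset.range K) (fun k _ => hdiff k)
      rw [Finset.sum_range_sub (fun k => R (2 ^ k - 1))] at h2
      simp only [pow_zero, Nat.sub_self, hR0, sub_zero] at h2
      refine h2.mono ?_
      rw [← Finset.mul_sum]
      have := sum_two_pow_mul_le_of_antitone ht ht0 K
      have := hsum.sum_le_tsum (Finset.range (2 ^ K - 1)) (fun m _ => ht0 m)
      linarith
    have h3 : ∑ i, ‖⟪f i, (T - R (2 ^ K - 1)) (e i)⟫_ℂ‖ ≤ n * t (2 ^ K - 1) := by
      have : ∀ i ∈ Finset.univ, ‖⟪f i, (T - R (2 ^ K - 1)) (e i)⟫_ℂ‖ ≤ t (2 ^ K - 1) := by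
        intro i _
        refine (norm_inner_le_norm _ _).trans ?_
        refine (mul_le_of_le_one_left (norm_nonneg _) (hf.norm_le_one i)).trans ?_
        refine (ContinuousLinearMap.le_opNorm _ _).trans ?_
        exact (mul_le_of_le_one_right (norm_nonneg _) (he.norm_le_one i)).trans (hTR _)
      simpa using Finset.sum_le_card_nsmul _ _ _ this
    calc ∑ i, ‖⟪f i, T (e i)⟫_ℂ‖
        ≤ ∑ i, (‖⟪f i, (T - R (2 ^ K - 1)) (e i)⟫_ℂ‖ + ‖⟪f i, R (2 ^ K - 1) (e i)⟫_ℂ‖) := by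
          refine Finset.sum_le_sum fun i _ => ?_
          refine le_trans (le_of_eq ?_) (norm_add_le _ _)
          rw [← inner_add_right, ← add_apply, sub_add_cancel]
      _ ≤ _ := by
          rw [Finset.sum_add_distrib]
          exact add_le_add h3 (h1 n e f he hf)
  have hlim : Filter.Tendsto (fun K : ℕ => n * t (2 ^ K - 1) + 12 * ∑' m, t m) Filter.atTop
      (nhds (n * 0 + 12 * ∑' m, t m)) := by
    refine ((hsum.tendsto_atTop_zero.comp ?_).const_mul _).add_const _
    exact Filter.tendsto_atTop_mono (fun K => Nat.le_sub_one_of_lt Nat.lt_two_pow_self)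
      Filter.tendsto_id
  simpa using ge_of_tendsto' hlim hK

lemma MemTraceClass.traceNormLE {T : H →L[ℂ] H} (hT : MemTraceClass T) :
    TraceNormLE T (12 * ∑' j, sNum T j) := by
  have key : ∀ ε : ℝ, 0 < ε → TraceNormLE T (12 * (∑' j, sNum T j + ε * 2)) := by
    intro ε hε
    have hlt : ∀ m : ℕ, sNum T m < sNum T m + ε * (1 / 2) ^ m := fun m => by
      have : 0 < ε * (1 / 2) ^ m := by positivity
      linarith
    choose R hR hTR using fun m => exists_rank_le_norm_sub_lt T (hlt m)
    have hg : Summable fun m : ℕ => ε * (1 / 2 : ℝ) ^ m := summable_geometric_two.mul_left _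
    have := TraceNormLE.of_approx (t := fun m => sNum T m + ε * (1 / 2) ^ m)
      ((sNum_antitone T).add fun a b hab => by
        have : (1 / 2 : ℝ) ^ b ≤ (1 / 2) ^ a := pow_le_pow_of_le_one (by norm_num) (by norm_num) hab
        gcongr)
      (Summable.add hT hg) hR (fun m => (hTR m).le)
    rwa [Summable.tsum_add hT hg, tsum_mul_left, tsum_geometric_two] at this
  intro n e f he hf
  refine le_of_forall_pos_le_add fun ε hε => ?_
  have := key (ε / 24) (by positivity) n e f he hf
  linarith

end TraceClass

section Exponential

open scoped InnerProductSpace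

variable {H : Type*} [NormedAddCommGroup H] [InnerProductSpace ℂ H] [CompleteSpace H]

lemma norm_exp_real_smul_I_smul_le {X : H →L[ℂ] H} (hX : IsSelfAdjoint X) (s : ℝ) :
    ‖NormedSpace.exp (s • Complex.I • X)‖ ≤ 1 := by
  have h1 : IsSelfAdjoint (s • X) := (IsSelfAdjoint.all s).smul hX
  have h2 := (selfAdjoint.expUnitary ⟨s • X, h1⟩).2
  rw [selfAdjoint.expUnitary_coe] at h2
  rw [smul_comm]
  have h3 := CStarRing.norm_star_mul_self (x := NormedSpace.exp (Complex.I • s • X))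
  rw [(Unitary.mem_iff.1 h2).1] at h3
  have h4 : ‖(1 : H →L[ℂ] H)‖ ≤ 1 := ContinuousLinearMap.norm_id_le
  nlinarith [norm_nonneg (NormedSpace.exp (Complex.I • s • X))]

lemma TraceNormLE.exp_I_smul_sub {X Y : H →L[ℂ] H} (hX : IsSelfAdjoint X) (hY : IsSelfAdjoint Y)
    {C : ℝ} (h : TraceNormLE (X - Y) C) :
    TraceNormLE (NormedSpace.exp (Complex.I • X) - NormedSpace.exp (Complex.I • Y)) C := by
  set G' : ℝ → H →L[ℂ] H := fun s => NormedSpace.exp (s • Complex.I • X) *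
    (Complex.I • (X - Y)) * NormedSpace.exp ((1 - s) • Complex.I • Y) with hG'
  have hderiv : ∀ s : ℝ, HasDerivAt (fun s : ℝ => NormedSpace.exp (s • Complex.I • X) *
      NormedSpace.exp ((1 - s) • Complex.I • Y)) (G' s) s := by
    intro s
    have h1 := hasDerivAt_exp_smul_const (𝕂 := ℝ) (Complex.I • X) s
    have h2 := (hasDerivAt_exp_smul_const' (𝕂 := ℝ) (Complex.I • Y) (1 - s)).scomp s
      ((hasDerivAt_id s).const_sub 1)
    refine (h1.mul h2).congr_deriv ?_
    simp only [hG', Function.comp, smul_sub, neg_smul, one_smul]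
    noncomm_ring
  have hcont : Continuous G' := by
    let +nondep : NormedAlgebra ℚ (H →L[ℂ] H) := .restrictScalars ℚ ℂ _
    fun_prop
  have hint := intervalIntegral.integral_eq_sub_of_hasDerivAt (a := 0) (b := 1)
    (fun s _ => hderiv s) (hcont.intervalIntegrable 0 1)
  rw [intervalIntegral.integral_of_le zero_le_one] at hint
  have hle : ∀ s, TraceNormLE (G' s) C := by
    intro s
    have := (h.smul Complex.I).contraction_mul_mul (norm_exp_real_smul_I_smul_le hX s)
      (norm_exp_real_smul_I_smul_le hY (1 - s))
    simpa [hG'] using this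
  have := TraceNormLE.integral (μ := MeasureTheory.volume.restrict (Set.Ioc (0 : ℝ) 1))
    (hcont.integrableOn_Ioc) (MeasureTheory.integrable_const C) hle
  rw [hint] at this
  simpa using this

end Exponential

section Phase

open scoped InnerProductSpace

variable {H : Type*} [NormedAddCommGroup H] [InnerProductSpace ℂ H] [CompleteSpace H]

/-- The character `z ↦ exp(i⟪w, z⟫)` of `ℂ = ℝ²`. -/
noncomputable def phase (w z : ℂ) : ℂ := Complex.exp (Complex.I * (⟪w, z⟫_ℝ : ℝ))

lemma continuous_phase_uncurry : Continuous fun p : ℂ × ℂ => phase p.1 p.2 := by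
  unfold phase
  fun_prop

lemma continuous_phase (w : ℂ) : Continuous (phase w) := by
  unfold phase
  fun_prop

lemma norm_phase (w z : ℂ) : ‖phase w z‖ = 1 := by
  rw [phase, mul_comm, Complex.norm_exp_ofReal_mul_I]

lemma cfc_phase_eq_exp (w : ℂ) (N : H →L[ℂ] H) (hN : IsStarNormal N) :
    cfc (phase w) N = NormedSpace.exp
      (Complex.I • ((1 / 2 : ℝ) • ((star w • N) + star (star w • N)))) := by
  have h1 : (fun z : ℂ => Complex.I * (⟪w, z⟫_ℝ : ℝ)) = fun z =>
      (Complex.I / 2) * (star w * z + w * star z) := by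
    ext z
    rw [Complex.inner]
    have := Complex.add_conj ((starRingEnd ℂ) w * z)
    simp only [map_mul, Complex.conj_conj, RCLike.star_def] at this ⊢
    rw [this]
    push_cast
    ring_nf
  have h2 : phase w = fun z => Complex.exp ((fun z : ℂ => Complex.I * (⟪w, z⟫_ℝ : ℝ)) z) := rfl
  rw [h2, h1, cfc_comp' Complex.exp _ N (by fun_prop) (by fun_prop),
    CFC.complex_exp_eq_normedSpace_exp]
  congr 1
  rw [cfc_const_mul _ _ N (by fun_prop), cfc_add (a := N) _ _ (by fun_prop) (by fun_prop),
    cfc_const_mul _ _ N (by fun_prop), cfc_const_mul _ _ N (by fun_prop), cfc_id' ℂ N,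
    cfc_star_id (a := N),
    star_smul, star_star, ← Complex.coe_smul, smul_smul]
  congr 1
  push_cast
  ring

lemma TraceNormLE.cfc_phase_sub {N₁ N₂ : H →L[ℂ] H} (h₁ : IsStarNormal N₁) (h₂ : IsStarNormal N₂)
    {C : ℝ} (h : TraceNormLE (N₁ - N₂) C) (w : ℂ) :
    TraceNormLE (cfc (phase w) N₁ - cfc (phase w) N₂) (‖w‖ * C) := by
  rw [cfc_phase_eq_exp w N₁ h₁, cfc_phase_eq_exp w N₂ h₂]
  have hsa : ∀ N : H →L[ℂ] H,
      IsSelfAdjoint ((1 / 2 : ℝ) • ((star w • N) + star (star w • N))) := fun N =>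
    (IsSelfAdjoint.all _).smul (IsSelfAdjoint.add_star_self _)
  refine TraceNormLE.exp_I_smul_sub (hsa N₁) (hsa N₂) ?_
  have h3 := ((h.smul (star w)).add (h.smul (star w)).adjoint).smul ((1 / 2 : ℝ) : ℂ)
  have h4 : ‖((1 / 2 : ℝ) : ℂ)‖ * (‖star w‖ * C + ‖star w‖ * C) = ‖w‖ * C := by
    rw [norm_star, Complex.norm_real]
    norm_num
    ring
  rw [h4] at h3
  convert h3 using 1
  rw [Complex.coe_smul, ← smul_sub, smul_sub (star w) N₁ N₂, star_sub]
  congr 1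
  abel

end Phase

section Fourier

open scoped InnerProductSpace

open MeasureTheory

lemma HasCompactSupport.exists_eq_integral_phase {θ : ℂ → ℂ} (h₁ : HasCompactSupport θ)
    (h₂ : ContDiff ℝ (⊤ : ℕ∞) θ) :
    ∃ φ : ℂ → ℂ, Continuous φ ∧ Integrable φ ∧ Integrable (fun w => ‖w‖ * ‖φ w‖) ∧
      ∀ z, θ z = ∫ w, φ w * phase ((2 * Real.pi) • w) z := by
  set S := h₁.toSchwartzMap h₂ with hS
  have hco : (S : ℂ → ℂ) = θ := rfl
  refine ⟨FourierTransform.fourier S, SchwartzMap.continuous _, SchwartzMap.integrable _, ?_, ?_⟩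
  · simpa using (FourierTransform.fourier S : SchwartzMap ℂ ℂ).integrable_pow_mul volume 1
  · intro z
    have h3 := (SchwartzMap.continuous S).fourierInv_fourier_eq S.integrable (by
      rw [← SchwartzMap.fourier_coe]
      exact SchwartzMap.integrable _)
    have h4 := congrFun h3 z
    rw [← SchwartzMap.fourier_coe, Real.fourierInv_eq', hco] at h4
    rw [← h4]
    refine integral_congr_ae (.of_forall fun w => ?_)
    simp only [smul_eq_mul]
    rw [mul_comm, phase, real_inner_smul_left, mul_comm Complex.I]

lemma phase_sub_mul (w z b : ℂ) (r s : ℝ) :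
    phase (r • w) (s • z - b) = phase (r • w) (-b) * phase ((r * s) • w) z := by
  simp only [phase, ← Complex.exp_add]
  congr 1
  simp only [real_inner_smul_left, inner_sub_right, real_inner_smul_right, inner_neg_right]
  push_cast
  ring

variable {H : Type*} [NormedAddCommGroup H] [InnerProductSpace ℂ H] [CompleteSpace H]

lemma integrable_smul_cfc_phase {ψ : ℂ → ℂ} (hψ : Continuous ψ) (hi : Integrable ψ) (r : ℝ)
    (N : H →L[ℂ] H) (hN : IsStarNormal N) :
    Integrable fun w => ψ w • cfc (phase (r • w)) N := by
  have hc : Continuous fun p : ℂ × ℂ => ψ p.1 * phase (r • p.1) p.2 :=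
    (hψ.comp continuous_fst).mul (continuous_phase_uncurry.comp
      ((continuous_fst.const_smul r).prodMk continuous_snd))
  have := integrable_cfc (μ := volume) (fun w z => ψ w * phase (r • w) z) (fun w => ‖ψ w‖) N
    hc.continuousOn (.of_forall fun w z _ => by simp [norm_phase]) hi.norm.hasFiniteIntegral
  refine this.congr (.of_forall fun w => ?_)
  exact cfc_const_mul _ _ N (continuous_phase _).continuousOn

lemma cfc_integral_phase {ψ : ℂ → ℂ} (hψ : Continuous ψ) (hi : Integrable ψ) (r : ℝ)
    (N : H →L[ℂ] H) (hN : IsStarNormal N) :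
    cfc (fun z => ∫ w, ψ w * phase (r • w) z) N = ∫ w, ψ w • cfc (phase (r • w)) N := by
  have hc : Continuous fun p : ℂ × ℂ => ψ p.1 * phase (r • p.1) p.2 :=
    (hψ.comp continuous_fst).mul (continuous_phase_uncurry.comp
      ((continuous_fst.const_smul r).prodMk continuous_snd))
  rw [cfc_integral (fun w z => ψ w * phase (r • w) z) (fun w => ‖ψ w‖) N
    hc.continuousOn (.of_forall fun w z _ => by simp [norm_phase]) hi.norm.hasFiniteIntegral]
  refine integral_congr_ae (.of_forall fun w => ?_)
  exact cfc_const_mul _ _ N (continuous_phase _).continuousOn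

lemma TraceNormLE.sum_cfc_mul_sub {θ φ : ℂ → ℂ} (hφ : Continuous φ) (hi : Integrable φ)
    (hi' : Integrable fun w => ‖w‖ * ‖φ w‖)
    (hθ : ∀ z, θ z = ∫ w, φ w * phase ((2 * Real.pi) • w) z)
    {N₁ N₂ : H →L[ℂ] H} (h₁ : IsStarNormal N₁) (h₂ : IsStarNormal N₂) {C : ℝ}
    (h : TraceNormLE (N₁ - N₂) C) {ι : Type*} (s : Finset ι) (c b : ι → ℂ) (u : ι → ℂ → ℂ)
    (hu : ∀ i, Continuous (u i)) {B r : ℝ} (hr : 0 ≤ r)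
    (hB : ∀ z, ∑ i ∈ s, ‖c i‖ * ‖u i z‖ ≤ B) :
    TraceNormLE (∑ i ∈ s, c i • (cfc (u i) N₁ *
      (cfc (fun z => θ (r • z - b i)) N₁ - cfc (fun z => θ (r • z - b i)) N₂)))
      (2 * Real.pi * (∫ w, ‖w‖ * ‖φ w‖) * (B * r * C)) := by
  have hB0 : 0 ≤ B := (Finset.sum_nonneg fun i _ => by positivity).trans (hB 0)
  set p : ι → ℂ → ℂ := fun i w => phase ((2 * Real.pi) • w) (-b i) with hp
  have hpc : ∀ i, Continuous (p i) := fun i => continuous_phase_uncurry.comp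
    ((continuous_const_smul _).prodMk continuous_const)
  have hpn : ∀ i w, ‖p i w‖ = 1 := fun i w => norm_phase _ _
  have hψc : ∀ i, Continuous fun w => φ w * p i w := fun i => hφ.mul (hpc i)
  have hψi : ∀ i, Integrable fun w => φ w * p i w := fun i =>
    hi.mul_bdd (c := 1) (hpc i).aestronglyMeasurable (.of_forall fun w => (hpn i w).le)
  set q : ℝ := 2 * Real.pi * r with hq
  have hθ' : ∀ i (N : H →L[ℂ] H), IsStarNormal N → cfc (fun z => θ (r • z - b i)) N =
      ∫ w, (φ w * p i w) • cfc (phase (q • w)) N := by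
    intro i N hN
    rw [← cfc_integral_phase (hψc i) (hψi i) q N hN]
    congr 1
    ext z
    rw [hθ]
    simp only [phase_sub_mul, hp, hq, mul_assoc]
  have hint : ∀ i (N : H →L[ℂ] H), IsStarNormal N →
      Integrable fun w => (φ w * p i w) • cfc (phase (q • w)) N := fun i N hN =>
    integrable_smul_cfc_phase (hψc i) (hψi i) q N hN
  set P : ℂ → H →L[ℂ] H := fun w => cfc (phase (q • w)) N₁ - cfc (phase (q • w)) N₂ with hP
  have hPi : ∀ i, Integrable fun w => (φ w * p i w) • P w := fun i =>
    ((hint i N₁ h₁).sub (hint i N₂ h₂)).congr (.of_forall fun w => by simp [hP, smul_sub])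
  have hPi' : ∀ i, Integrable fun w => c i • (cfc (u i) N₁ * ((φ w * p i w) • P w)) := fun i =>
    ((hPi i).const_mul (cfc (u i) N₁)).smul (c i)
  set A : ℂ → H →L[ℂ] H := fun w => ∑ i ∈ s, (c i * p i w) • cfc (u i) N₁ with hA
  have hAn : ∀ w, ‖A w‖ ≤ B := by
    intro w
    have : A w = cfc (∑ i ∈ s, fun z => (c i * p i w) * u i z) N₁ := by
      rw [cfc_sum _ _ _ fun i _ => ((hu i).const_mul _).continuousOn]
      exact Finset.sum_congr rfl fun i _ => (cfc_const_mul _ _ N₁ (hu i).continuousOn).symm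
    rw [this]
    refine norm_cfc_le hB0 fun z _ => ?_
    rw [Finset.sum_apply]
    refine (norm_sum_le _ _).trans (le_trans (le_of_eq ?_) (hB z))
    exact Finset.sum_congr rfl fun i _ => by rw [norm_mul, norm_mul, hpn, mul_one]
  have hsum : ∑ i ∈ s, c i • (cfc (u i) N₁ *
      (cfc (fun z => θ (r • z - b i)) N₁ - cfc (fun z => θ (r • z - b i)) N₂)) =
      ∫ w, φ w • (A w * P w) := by
    calc _ = ∑ i ∈ s, ∫ w, c i • (cfc (u i) N₁ * ((φ w * p i w) • P w)) := by
          refine Finset.sum_congr rfl fun i _ => ?_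
          rw [integral_smul, integral_const_mul_of_integrable (hPi i), hθ' i N₁ h₁, hθ' i N₂ h₂,
            ← integral_sub (hint i N₁ h₁) (hint i N₂ h₂)]
          simp only [hP, smul_sub]
      _ = ∫ w, ∑ i ∈ s, c i • (cfc (u i) N₁ * ((φ w * p i w) • P w)) :=
          (integral_finsetSum _ fun i _ => hPi' i).symm
      _ = _ := by
          refine integral_congr_ae (.of_forall fun w => ?_)
          simp only [hA, Finset.sum_mul, Finset.smul_sum]
          refine Finset.sum_congr rfl fun i _ => ?_
          rw [mul_smul_comm, smul_mul_assoc, smul_smul, smul_smul]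
          congr 1
          ring
  have hsumi : Integrable fun w => φ w • (A w * P w) := by
    refine (integrable_finsetSum s fun i _ => hPi' i).congr (.of_forall fun w => ?_)
    simp only [hA, Finset.sum_mul, Finset.smul_sum]
    refine Finset.sum_congr rfl fun i _ => ?_
    rw [mul_smul_comm, smul_mul_assoc, smul_smul, smul_smul]
    congr 1
    ring
  rw [hsum]
  have hfin := TraceNormLE.integral hsumi
    (C := fun w => (2 * Real.pi * (B * r * C)) * (‖w‖ * ‖φ w‖)) (hi'.const_mul _) (fun w => by
      have h3 := (((h.cfc_phase_sub h₁ h₂ (q • w))).mul_left (hAn w)).smul (φ w)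
      refine h3.mono (le_of_eq ?_)
      rw [norm_smul, hq, Real.norm_of_nonneg (by positivity)]
      ring)
  refine hfin.mono (le_of_eq ?_)
  rw [integral_const_mul]
  ring

lemma TraceNormLE.sum_sub_mul_cfc {θ φ : ℂ → ℂ} (hφ : Continuous φ) (hi : Integrable φ)
    (hi' : Integrable fun w => ‖w‖ * ‖φ w‖)
    (hθ : ∀ z, θ z = ∫ w, φ w * phase ((2 * Real.pi) • w) z) (hθr : ∀ z, star (θ z) = θ z)
    {N₁ N₂ : H →L[ℂ] H} (h₁ : IsStarNormal N₁) (h₂ : IsStarNormal N₂) {C : ℝ}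
    (h : TraceNormLE (N₁ - N₂) C) {ι : Type*} (s : Finset ι) (c b : ι → ℂ) (u : ι → ℂ → ℂ)
    (hu : ∀ i, Continuous (u i)) (hur : ∀ i z, star (u i z) = u i z) {B r : ℝ} (hr : 0 ≤ r)
    (hB : ∀ z, ∑ i ∈ s, ‖c i‖ * ‖u i z‖ ≤ B) :
    TraceNormLE (∑ i ∈ s, c i •
      ((cfc (fun z => θ (r • z - b i)) N₁ - cfc (fun z => θ (r • z - b i)) N₂) * cfc (u i) N₂))
      (2 * Real.pi * (∫ w, ‖w‖ * ‖φ w‖) * (B * r * C)) := by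
  have h' : TraceNormLE (N₂ - N₁) C := by
    have := h.smul (-1)
    simpa using this
  have := ((TraceNormLE.sum_cfc_mul_sub hφ hi hi' hθ h₂ h₁ h' s (fun i => star (c i)) b u hu hr
    (by simpa using hB)).adjoint).smul (-1)
  simp only [norm_neg, norm_one, one_mul] at this
  convert this using 1
  rw [star_sum, Finset.smul_sum]
  refine Finset.sum_congr rfl fun i _ => ?_
  simp only [star_smul, star_star, star_mul, star_sub, ← cfc_star, hθr, hur]
  rw [smul_comm, neg_one_smul, ← neg_mul, neg_sub]

end Fourier

section Bump

/-- A smooth bump on `ℝ`, supported in `[-2/3, 2/3]`, whose integer translates sum to `1`. -/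
noncomputable def bumpReal (x : ℝ) : ℝ :=
  Real.smoothTransition (3 * x + 2) - Real.smoothTransition (3 * x - 1)

lemma bumpReal_nonneg (x : ℝ) : 0 ≤ bumpReal x :=
  sub_nonneg.2 (Real.smoothTransition.monotone (by linarith))

lemma bumpReal_eq_zero {x : ℝ} (hx : 2 / 3 ≤ |x|) : bumpReal x = 0 := by
  rcases le_abs.1 hx with h | h
  · rw [bumpReal, Real.smoothTransition.one_of_one_le (by linarith),
      Real.smoothTransition.one_of_one_le (by linarith), sub_self]
  · rw [bumpReal, Real.smoothTransition.zero_of_nonpos (by linarith),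
      Real.smoothTransition.zero_of_nonpos (by linarith), sub_self]

lemma contDiff_bumpReal {n : ℕ∞} : ContDiff ℝ n bumpReal := by
  have := Real.smoothTransition.contDiff (n := n)
  unfold bumpReal
  fun_prop

lemma sum_bumpReal (x : ℝ) (L : ℕ) :
    ∑ a ∈ Finset.Icc (-L : ℤ) L, bumpReal (x - a) =
      Real.smoothTransition (3 * x + 3 * L + 2) - Real.smoothTransition (3 * x - 3 * L - 1) := by
  induction L with
  | zero => simp [bumpReal]
  | succ L ih =>
    have hset : Finset.Icc (-(L + 1 : ℕ) : ℤ) (L + 1 : ℕ) =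
        insert (-(L + 1 : ℤ)) (insert (L + 1 : ℤ) (Finset.Icc (-L : ℤ) L)) := by
      ext a
      simp only [Finset.mem_Icc, Finset.mem_insert]
      push_cast
      omega
    rw [hset, Finset.sum_insert (by simp; omega), Finset.sum_insert (by simp), ih]
    simp only [bumpReal]
    push_cast
    ring_nf

lemma sum_bumpReal_le_one (x : ℝ) (L : ℕ) :
    ∑ a ∈ Finset.Icc (-L : ℤ) L, bumpReal (x - a) ≤ 1 := by
  rw [sum_bumpReal]
  linarith [Real.smoothTransition.le_one (3 * x + 3 * L + 2),
    Real.smoothTransition.nonneg (3 * x - 3 * L - 1)]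

lemma sum_bumpReal_eq_one {x : ℝ} {L : ℕ} (hx : |x| ≤ L) :
    ∑ a ∈ Finset.Icc (-L : ℤ) L, bumpReal (x - a) = 1 := by
  have := abs_le.1 hx
  rw [sum_bumpReal, Real.smoothTransition.one_of_one_le (by linarith),
    Real.smoothTransition.zero_of_nonpos (by linarith), sub_zero]

/-- The tensor product bump on `ℂ = ℝ²`. -/
noncomputable def bump (z : ℂ) : ℂ := ((bumpReal z.re * bumpReal z.im : ℝ) : ℂ)

/-- The Gaussian integer with the given coordinates. -/
def latticePoint (n : ℤ × ℤ) : ℂ := ⟨n.1, n.2⟩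

/-- The box `[-L, L]²` in `ℤ²`. -/
noncomputable def latticeBox (L : ℕ) : Finset (ℤ × ℤ) :=
  Finset.Icc (-L : ℤ) L ×ˢ Finset.Icc (-L : ℤ) L

lemma star_bump (z : ℂ) : star (bump z) = bump z := Complex.conj_ofReal _

lemma norm_bump (z : ℂ) : ‖bump z‖ = bumpReal z.re * bumpReal z.im := by
  rw [bump, Complex.norm_real,
    Real.norm_of_nonneg (mul_nonneg (bumpReal_nonneg _) (bumpReal_nonneg _))]

lemma contDiff_bump : ContDiff ℝ (⊤ : ℕ∞) bump := by
  have h := contDiff_bumpReal (n := ⊤)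
  exact Complex.ofRealCLM.contDiff.comp
    ((h.comp Complex.reCLM.contDiff).mul (h.comp Complex.imCLM.contDiff))

lemma continuous_bump : Continuous bump := contDiff_bump.continuous

lemma abs_lt_of_bump_ne_zero {z : ℂ} (hz : bump z ≠ 0) : |z.re| < 2 / 3 ∧ |z.im| < 2 / 3 := by
  constructor
  all_goals
    by_contra! h
    exact hz (by simp [bump, bumpReal_eq_zero h])

lemma norm_le_one_of_bump_ne_zero {z : ℂ} (hz : bump z ≠ 0) : ‖z‖ ≤ 1 := by
  obtain ⟨h1, h2⟩ := abs_lt_of_bump_ne_zero hz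
  rw [← sq_le_one_iff₀ (norm_nonneg z), Complex.sq_norm, Complex.normSq_apply,
    ← abs_mul_abs_self z.re, ← abs_mul_abs_self z.im]
  nlinarith [abs_nonneg z.re, abs_nonneg z.im]

lemma hasCompactSupport_bump : HasCompactSupport bump := by
  refine HasCompactSupport.of_support_subset_isCompact (isCompact_closedBall (0 : ℂ) 1) ?_
  intro z hz
  simpa using norm_le_one_of_bump_ne_zero hz

lemma sum_norm_bump_le_one (z : ℂ) (L : ℕ) :
    ∑ n ∈ latticeBox L, ‖bump (z - latticePoint n)‖ ≤ 1 := by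
  simp only [norm_bump, latticePoint, Complex.sub_re, Complex.sub_im]
  rw [latticeBox, Finset.sum_product, ← Finset.sum_mul_sum _ _ (fun a : ℤ => bumpReal (z.re - a))
      (fun b : ℤ => bumpReal (z.im - b))]
  exact mul_le_one₀ (sum_bumpReal_le_one _ _)
    (Finset.sum_nonneg fun _ _ => bumpReal_nonneg _) (sum_bumpReal_le_one _ _)

lemma sum_bump_eq_one {z : ℂ} {L : ℕ} (hz : ‖z‖ ≤ L) :
    ∑ n ∈ latticeBox L, bump (z - latticePoint n) = 1 := by
  simp only [bump, latticePoint, Complex.sub_re, Complex.sub_im]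
  rw [← Complex.ofReal_sum, latticeBox, Finset.sum_product,
    ← Finset.sum_mul_sum _ _ (fun a : ℤ => bumpReal (z.re - a))
      (fun b : ℤ => bumpReal (z.im - b)),
    sum_bumpReal_eq_one ((Complex.abs_re_le_norm z).trans hz),
    sum_bumpReal_eq_one ((Complex.abs_im_le_norm z).trans hz)]
  simp

end Bump

section Discretization

/-- The smooth interpolation at scale `l` of the values of `f` on the lattice `l ℤ[i]`. -/
noncomputable def discretize (f : ℂ → ℂ) (L : ℕ) (l : ℝ) (z : ℂ) : ℂ :=
  ∑ n ∈ latticeBox L, f (l • latticePoint n) * bump (l⁻¹ • z - latticePoint n)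

/-- Pairs of lattice points for which the bumps at scales `1` and `2` may overlap. -/
noncomputable def latticePairs (L : ℕ) : Finset ((ℤ × ℤ) × (ℤ × ℤ)) :=
  (latticeBox L ×ˢ latticeBox L).filter
    fun p => |p.1.1 - 2 * p.2.1| ≤ 1 ∧ |p.1.2 - 2 * p.2.2| ≤ 1

lemma continuous_bump_smul_sub (r : ℝ) (b : ℂ) : Continuous fun z => bump (r • z - b) :=
  continuous_bump.comp (by fun_prop)

lemma continuous_discretize (f : ℂ → ℂ) (L : ℕ) (l : ℝ) : Continuous (discretize f L l) :=
  continuous_finsetSum _ fun _ _ => (continuous_bump_smul_sub _ _).const_mul _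

variable {f : ℂ → ℂ} {M α : ℝ}

lemma norm_sub_discretize_le (hα : 0 < α) (hM : 0 ≤ M)
    (hf : ∀ z₁ z₂ : ℂ, ‖f z₁ - f z₂‖ ≤ M * ‖z₁ - z₂‖ ^ α) {l : ℝ} (hl : 0 < l) {L : ℕ} {z : ℂ}
    (hz : ‖l⁻¹ • z‖ ≤ L) : ‖f z - discretize f L l z‖ ≤ M * l ^ α := by
  have h1 : f z - discretize f L l z = ∑ n ∈ latticeBox L,
      (f z - f (l • latticePoint n)) * bump (l⁻¹ • z - latticePoint n) := by
    simp only [sub_mul, Finset.sum_sub_distrib, ← Finset.mul_sum, sum_bump_eq_one hz, mul_one,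
      discretize]
  rw [h1]
  calc _ ≤ ∑ n ∈ latticeBox L, M * l ^ α * ‖bump (l⁻¹ • z - latticePoint n)‖ := by
        refine (norm_sum_le _ _).trans (Finset.sum_le_sum fun n _ => ?_)
        rw [norm_mul]
        by_cases hb : bump (l⁻¹ • z - latticePoint n) = 0
        · simp only [hb, norm_zero, mul_zero, le_refl]
        have h2 := norm_le_one_of_bump_ne_zero hb
        have h3 : ‖z - l • latticePoint n‖ ≤ l := by
          have : z - l • latticePoint n = l • (l⁻¹ • z - latticePoint n) := by
            rw [smul_sub, smul_inv_smul₀ hl.ne']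
          rw [this, norm_smul, Real.norm_of_nonneg hl.le]
          exact mul_le_of_le_one_right hl.le h2
        have h4 : ‖z - l • latticePoint n‖ ^ α ≤ l ^ α :=
          Real.rpow_le_rpow (norm_nonneg _) h3 hα.le
        have h5 := hf z (l • latticePoint n)
        gcongr
        exact h5.trans (by gcongr)
    _ ≤ M * l ^ α := by
        rw [← Finset.mul_sum]
        exact mul_le_of_le_one_right (by positivity) (sum_norm_bump_le_one _ _)

lemma discretize_eq_of_norm_le {l : ℝ} {L : ℕ} {z : ℂ} (hz : ‖l⁻¹ • z‖ ≤ L)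
    (hz' : ‖l⁻¹ • z‖ ≤ 1 / 3) : discretize f L l z = f 0 := by
  have h1 : discretize f L l z =
      ∑ n ∈ latticeBox L, f 0 * bump (l⁻¹ • z - latticePoint n) := by
    refine Finset.sum_congr rfl fun n _ => ?_
    by_cases hb : bump (l⁻¹ • z - latticePoint n) = 0
    · simp only [hb, mul_zero]
    have key : ∀ {x : ℝ} {a : ℤ}, |x| ≤ 1 / 3 → |x - a| < 2 / 3 → a = 0 := by
      intro x a hx hxa
      have h2 := abs_le.1 hx
      have h3 := abs_lt.1 hxa
      have h4 : (a : ℝ) < 1 := by linarith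
      have h5 : (-1 : ℝ) < a := by linarith
      norm_cast at h4 h5
      omega
    obtain ⟨h2, h3⟩ := abs_lt_of_bump_ne_zero hb
    have h4 := key ((Complex.abs_re_le_norm _).trans hz') h2
    have h5 := key ((Complex.abs_im_le_norm _).trans hz') h3
    have h6 : latticePoint n = 0 := by
      simp [latticePoint, h4, h5, Complex.ext_iff]
    rw [h6, smul_zero]
  rw [h1, ← Finset.mul_sum, sum_bump_eq_one hz, mul_one]

lemma discretize_sub_discretize {l : ℝ} (hl : 0 < l) {L : ℕ} {z : ℂ} (hz : ‖l⁻¹ • z‖ ≤ L) :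
    discretize f L l z - discretize f L (2 * l) z = ∑ p ∈ latticePairs L,
      (f (l • latticePoint p.1) - f ((2 * l) • latticePoint p.2)) *
      (bump (l⁻¹ • z - latticePoint p.1) * bump ((2 * l)⁻¹ • z - latticePoint p.2)) := by
  have hhalf : (2 * l)⁻¹ • z = (1 / 2 : ℝ) • l⁻¹ • z := by
    rw [smul_smul]
    congr 1
    field_simp
  have hz2 : ‖(2 * l)⁻¹ • z‖ ≤ L := by
    rw [hhalf, norm_smul, Real.norm_of_nonneg (by norm_num)]
    linarith [norm_nonneg (l⁻¹ • z)]
  rw [latticePairs, Finset.sum_filter_of_ne, Finset.sum_product]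
  · have h1 : discretize f L l z = ∑ n ∈ latticeBox L, ∑ m ∈ latticeBox L,
        f (l • latticePoint n) * (bump (l⁻¹ • z - latticePoint n) *
          bump ((2 * l)⁻¹ • z - latticePoint m)) := by
      simp only [← mul_assoc, ← Finset.mul_sum, sum_bump_eq_one hz2, mul_one, discretize]
    have h2 : discretize f L (2 * l) z = ∑ n ∈ latticeBox L, ∑ m ∈ latticeBox L,
        f ((2 * l) • latticePoint m) * (bump (l⁻¹ • z - latticePoint n) *
          bump ((2 * l)⁻¹ • z - latticePoint m)) := by
      rw [Finset.sum_comm]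
      simp only [mul_left_comm _ (bump (l⁻¹ • z - _)), ← Finset.sum_mul, sum_bump_eq_one hz,
        one_mul, discretize]
    rw [h1, h2]
    simp only [sub_mul, Finset.sum_sub_distrib]
  · intro p _ hp
    obtain ⟨h1, h2⟩ := mul_ne_zero_iff.1 (right_ne_zero_of_mul hp)
    have key : ∀ {x : ℝ} {a b : ℤ}, |x - a| < 2 / 3 → |1 / 2 * x - b| < 2 / 3 →
        |a - 2 * b| ≤ 1 := by
      intro x a b hxa hxb
      have h2 := abs_lt.1 hxa
      have h3 := abs_lt.1 hxb
      have h4 : ((a - 2 * b : ℤ) : ℝ) < 2 := by push_cast; linarith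
      have h5 : ((-2 : ℤ) : ℝ) < (a - 2 * b : ℤ) := by push_cast; linarith
      norm_cast at h4 h5
      rw [abs_le]
      omega
    obtain ⟨h3, h4⟩ := abs_lt_of_bump_ne_zero h1
    rw [hhalf] at h2
    obtain ⟨h5, h6⟩ := abs_lt_of_bump_ne_zero h2
    rw [Complex.sub_re, Complex.real_smul, Complex.re_ofReal_mul] at h5
    rw [Complex.sub_im, Complex.real_smul, Complex.im_ofReal_mul] at h6
    exact ⟨key h3 h5, key h4 h6⟩

lemma norm_coeff_le_of_mem_latticePairs (hα : 0 < α) (hα1 : α < 1) (hM : 0 ≤ M)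
    (hf : ∀ z₁ z₂ : ℂ, ‖f z₁ - f z₂‖ ≤ M * ‖z₁ - z₂‖ ^ α) {l : ℝ} (hl : 0 < l) {L : ℕ}
    {p : (ℤ × ℤ) × (ℤ × ℤ)} (hp : p ∈ latticePairs L) :
    ‖f (l • latticePoint p.1) - f ((2 * l) • latticePoint p.2)‖ ≤ 2 * M * l ^ α := by
  obtain ⟨-, h1, h2⟩ := Finset.mem_filter.1 hp
  have h3 : ‖latticePoint p.1 - (2 : ℝ) • latticePoint p.2‖ ≤ 2 := by
    refine (Complex.norm_le_abs_re_add_abs_im _).trans ?_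
    have h4 : |((p.1.1 - 2 * p.2.1 : ℤ) : ℝ)| ≤ 1 := by exact_mod_cast h1
    have h5 : |((p.1.2 - 2 * p.2.2 : ℤ) : ℝ)| ≤ 1 := by exact_mod_cast h2
    push_cast at h4 h5
    simp only [latticePoint, Complex.sub_re, Complex.sub_im, Complex.real_smul,
      Complex.re_ofReal_mul, Complex.im_ofReal_mul]
    linarith
  have h6 : ‖l • latticePoint p.1 - (2 * l) • latticePoint p.2‖ ≤ 2 * l := by
    rw [mul_comm 2 l, mul_smul, ← smul_sub, norm_smul, Real.norm_of_nonneg hl.le]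
    gcongr
  refine (hf _ _).trans ?_
  have h7 : ‖l • latticePoint p.1 - (2 * l) • latticePoint p.2‖ ^ α ≤ 2 * l ^ α := by
    refine (Real.rpow_le_rpow (norm_nonneg _) h6 hα.le).trans ?_
    rw [Real.mul_rpow (by norm_num) hl.le]
    gcongr
    exact Real.rpow_le_self_of_one_le (by norm_num) hα1.le
  calc _ ≤ M * (2 * l ^ α) := by gcongr
    _ = _ := by ring

lemma sum_latticePairs_le {L : ℕ} (φ : (ℤ × ℤ) × (ℤ × ℤ) → ℤ × ℤ)
    (hφ : φ = Prod.fst ∨ φ = Prod.snd) {g : ℤ × ℤ → ℝ} (hg : ∀ n, 0 ≤ g n) :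
    ∑ p ∈ latticePairs L, g (φ p) ≤ 9 * ∑ n ∈ latticeBox L, g n := by
  set ψ : (ℤ × ℤ) × (ℤ × ℤ) → (ℤ × ℤ) × (ℤ × ℤ) :=
    fun p => (φ p, (p.1.1 - 2 * p.2.1, p.1.2 - 2 * p.2.2)) with hψ
  have hinj : Set.InjOn ψ (latticePairs L) := by
    rintro ⟨⟨a, b⟩, ⟨c, d⟩⟩ _ ⟨⟨a', b'⟩, ⟨c', d'⟩⟩ _ h
    rcases hφ with rfl | rfl <;> simp only [hψ, Prod.mk.injEq] at h ⊢ <;> omega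
  have h1 : ∑ p ∈ latticePairs L, g (φ p) = ∑ q ∈ (latticePairs L).image ψ, g q.1 := by
    rw [Finset.sum_image hinj]
  have h2 : (latticePairs L).image ψ ⊆ latticeBox L ×ˢ latticeBox 1 := by
    intro q hq
    obtain ⟨p, hp, rfl⟩ := Finset.mem_image.1 hq
    obtain ⟨h3, h4, h5⟩ := Finset.mem_filter.1 hp
    refine Finset.mem_product.2 ⟨?_, ?_⟩
    · rcases hφ with rfl | rfl
      exacts [(Finset.mem_product.1 h3).1, (Finset.mem_product.1 h3).2]
    · rw [abs_le] at h4 h5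
      simp only [hψ, latticeBox, Finset.mem_product, Finset.mem_Icc]
      push_cast
      exact ⟨h4, h5⟩
  rw [h1]
  refine (Finset.sum_le_sum_of_subset_of_nonneg h2 fun q _ _ => hg _).trans (le_of_eq ?_)
  rw [Finset.sum_product]
  simp only [Finset.sum_const, Finset.mul_sum]
  have : (latticeBox 1).card = 9 := by rw [latticeBox]; rfl
  simp [this]

end Discretization

section HolderEstimate

open MeasureTheory

variable {f : ℂ → ℂ} {M α : ℝ}

lemma continuous_of_norm_sub_le_rpow (hα : 0 < α)
    (hf : ∀ z₁ z₂ : ℂ, ‖f z₁ - f z₂‖ ≤ M * ‖z₁ - z₂‖ ^ α) : Continuous f := by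
  rw [continuous_iff_continuousAt]
  intro z
  rw [ContinuousAt, tendsto_iff_norm_sub_tendsto_zero]
  refine squeeze_zero (fun _ => norm_nonneg _) (fun w => hf w z) ?_
  have h : Continuous fun w : ℂ => M * ‖w - z‖ ^ α :=
    ((by fun_prop : Continuous fun w : ℂ => ‖w - z‖).rpow_const fun _ => Or.inr hα.le).const_mul M
  have := h.tendsto z
  simpa [Real.zero_rpow hα.ne'] using this

variable {H : Type*} [NormedAddCommGroup H] [InnerProductSpace ℂ H] [CompleteSpace H]

lemma norm_le_of_mem_spectrum {N : H →L[ℂ] H} {z : ℂ} (hz : z ∈ spectrum ℂ N) : ‖z‖ ≤ ‖N‖ :=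
  (spectrum.norm_le_norm_mul_of_mem hz).trans
    (mul_le_of_le_one_right (norm_nonneg _) ContinuousLinearMap.norm_id_le)

lemma norm_inv_smul_le_of_mem_spectrum {N : H →L[ℂ] H} {z : ℂ} (hz : z ∈ spectrum ℂ N)
    {l x : ℝ} (hl : 0 < l) (hN : ‖N‖ ≤ l * x) : ‖l⁻¹ • z‖ ≤ x := by
  rw [norm_smul, norm_inv, Real.norm_of_nonneg hl.le, inv_mul_le_iff₀ hl]
  exact (norm_le_of_mem_spectrum hz).trans hN

lemma cfc_discretize_sub {l : ℝ} (hl : 0 < l) {L : ℕ} {N : H →L[ℂ] H}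
    (hN : ‖N‖ ≤ l * L) :
    cfc (discretize f L l) N - cfc (discretize f L (2 * l)) N = ∑ p ∈ latticePairs L,
      (f (l • latticePoint p.1) - f ((2 * l) • latticePoint p.2)) •
      (cfc (fun z => bump (l⁻¹ • z - latticePoint p.1)) N *
        cfc (fun z => bump ((2 * l)⁻¹ • z - latticePoint p.2)) N) := by
  have hc : ∀ (r : ℝ) (b : ℂ), ContinuousOn (fun z => bump (r • z - b)) (spectrum ℂ N) :=
    fun r b => (continuous_bump_smul_sub r b).continuousOn
  have hcm : ∀ p : (ℤ × ℤ) × (ℤ × ℤ), ContinuousOn (fun z => bump (l⁻¹ • z - latticePoint p.1) *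
      bump ((2 * l)⁻¹ • z - latticePoint p.2)) (spectrum ℂ N) := fun p => (hc _ _).mul (hc _ _)
  have hcs : ∀ p : (ℤ × ℤ) × (ℤ × ℤ), ContinuousOn (fun z =>
      (f (l • latticePoint p.1) - f ((2 * l) • latticePoint p.2)) *
      (bump (l⁻¹ • z - latticePoint p.1) * bump ((2 * l)⁻¹ • z - latticePoint p.2)))
      (spectrum ℂ N) := fun p => continuousOn_const.mul (hcm p)
  rw [← cfc_sub _ _ N (continuous_discretize f L l).continuousOn
    (continuous_discretize f L (2 * l)).continuousOn,
    cfc_congr fun z hz => discretize_sub_discretize (f := f) hl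
      (norm_inv_smul_le_of_mem_spectrum hz hl hN)]
  calc _ = cfc (∑ p ∈ latticePairs L, fun z =>
        (f (l • latticePoint p.1) - f ((2 * l) • latticePoint p.2)) *
        (bump (l⁻¹ • z - latticePoint p.1) * bump ((2 * l)⁻¹ • z - latticePoint p.2))) N := by
        congr 1
        ext z
        rw [Finset.sum_apply]
    _ = _ := by
        rw [cfc_sum _ _ _ fun p _ => hcs p]
        refine Finset.sum_congr rfl fun p _ => ?_
        rw [cfc_const_mul _ _ N (hcm p), cfc_mul _ _ N (hc _ _) (hc _ _)]

lemma TraceNormLE.cfc_discretize_sub {φ : ℂ → ℂ} (hφ : Continuous φ) (hi : Integrable φ)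
    (hi' : Integrable fun w => ‖w‖ * ‖φ w‖)
    (hθ : ∀ z, bump z = ∫ w, φ w * phase ((2 * Real.pi) • w) z)
    (hα : 0 < α) (hα1 : α < 1) (hM : 0 ≤ M)
    (hf : ∀ z₁ z₂ : ℂ, ‖f z₁ - f z₂‖ ≤ M * ‖z₁ - z₂‖ ^ α)
    {N₁ N₂ : H →L[ℂ] H} (h₁ : IsStarNormal N₁) (h₂ : IsStarNormal N₂) {C : ℝ}
    (h : TraceNormLE (N₁ - N₂) C) {l : ℝ} (hl : 0 < l) {L : ℕ}
    (hN₁ : ‖N₁‖ ≤ l * L) (hN₂ : ‖N₂‖ ≤ l * L) :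
    TraceNormLE ((cfc (discretize f L l) N₁ - cfc (discretize f L l) N₂) -
      (cfc (discretize f L (2 * l)) N₁ - cfc (discretize f L (2 * l)) N₂))
      (54 * Real.pi * (∫ w, ‖w‖ * ‖φ w‖) * (M * C * l ^ (α - 1))) := by
  set c : (ℤ × ℤ) × (ℤ × ℤ) → ℂ :=
    fun p => f (l • latticePoint p.1) - f ((2 * l) • latticePoint p.2) with hc
  have hB : ∀ (r : ℝ) (π : (ℤ × ℤ) × (ℤ × ℤ) → ℤ × ℤ), (π = Prod.fst ∨ π = Prod.snd) → ∀ z : ℂ,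
      ∑ p ∈ latticePairs L, ‖c p‖ * ‖bump (r • z - latticePoint (π p))‖ ≤ 18 * M * l ^ α := by
    intro r π hπ z
    calc _ ≤ ∑ p ∈ latticePairs L, 2 * M * l ^ α * ‖bump (r • z - latticePoint (π p))‖ := by
          refine Finset.sum_le_sum fun p hp => ?_
          gcongr
          exact norm_coeff_le_of_mem_latticePairs hα hα1 hM hf hl hp
      _ ≤ 2 * M * l ^ α * (9 * 1) := by
          rw [← Finset.mul_sum]
          gcongr
          refine (sum_latticePairs_le π hπ
            (g := fun n => ‖bump (r • z - latticePoint n)‖) fun _ => norm_nonneg _).trans ?_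
          gcongr
          exact sum_norm_bump_le_one _ _
      _ = _ := by ring
  have hleft := TraceNormLE.sum_cfc_mul_sub hφ hi hi' hθ h₁ h₂ h (latticePairs L) c
    (fun p => latticePoint p.2) (fun p z => bump (l⁻¹ • z - latticePoint p.1))
    (fun _ => continuous_bump_smul_sub _ _) (r := (2 * l)⁻¹) (by positivity)
    (hB l⁻¹ Prod.fst (Or.inl rfl))
  have hright := TraceNormLE.sum_sub_mul_cfc hφ hi hi' hθ star_bump h₁ h₂ h (latticePairs L) c
    (fun p => latticePoint p.1) (fun p z => bump ((2 * l)⁻¹ • z - latticePoint p.2))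
    (fun _ => continuous_bump_smul_sub _ _) (fun _ _ => star_bump _) (r := l⁻¹) (by positivity)
    (hB (2 * l)⁻¹ Prod.snd (Or.inr rfl))
  have hsum := hleft.add hright
  have hC : 2 * Real.pi * (∫ w, ‖w‖ * ‖φ w‖) * (18 * M * l ^ α * (2 * l)⁻¹ * C) +
      2 * Real.pi * (∫ w, ‖w‖ * ‖φ w‖) * (18 * M * l ^ α * l⁻¹ * C) =
      54 * Real.pi * (∫ w, ‖w‖ * ‖φ w‖) * (M * C * l ^ (α - 1)) := by
    rw [Real.rpow_sub_one hl.ne', mul_inv]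
    ring
  rw [hC] at hsum
  convert hsum using 1
  rw [sub_sub_sub_comm, _root_.cfc_discretize_sub hl hN₁, _root_.cfc_discretize_sub hl hN₂,
    ← Finset.sum_sub_distrib, ← Finset.sum_add_distrib]
  refine Finset.sum_congr rfl fun p _ => ?_
  rw [← smul_sub, ← smul_add]
  congr 1
  noncomm_ring

lemma sNum_cfc_sub_le {φ : ℂ → ℂ} (hφ : Continuous φ) (hi : Integrable φ)
    (hi' : Integrable fun w => ‖w‖ * ‖φ w‖)
    (hθ : ∀ z, bump z = ∫ w, φ w * phase ((2 * Real.pi) • w) z)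
    (hα : 0 < α) (hα1 : α < 1) (hM : 0 ≤ M)
    (hf : ∀ z₁ z₂ : ℂ, ‖f z₁ - f z₂‖ ≤ M * ‖z₁ - z₂‖ ^ α)
    {N₁ N₂ : H →L[ℂ] H} (h₁ : IsStarNormal N₁) (h₂ : IsStarNormal N₂) {C : ℝ}
    (h : TraceNormLE (N₁ - N₂) C) {δ : ℝ} (hδ : 0 < δ) (j : ℕ) :
    sNum (cfc f N₁ - cfc f N₂) (2 * j) ≤ 2 * (M * δ ^ α) +
      54 * Real.pi * (∫ w, ‖w‖ * ‖φ w‖) * (M * C * δ ^ (α - 1)) * (1 - 2 ^ (α - 1))⁻¹ /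
        (j + 1) := by
  have hfc := continuous_of_norm_sub_le_rpow hα hf
  set A : ℝ := 54 * Real.pi * (∫ w, ‖w‖ * ‖φ w‖) with hA
  have hA0 : 0 ≤ A := mul_nonneg (by positivity) (integral_nonneg fun w => by positivity)
  have hC0 := h.nonneg
  obtain ⟨L, hL⟩ := exists_nat_ge (max ‖N₁‖ ‖N₂‖ / δ)
  obtain ⟨K, hK⟩ := pow_unbounded_of_one_lt (3 * max ‖N₁‖ ‖N₂‖ / δ) (one_lt_two : (1 : ℝ) < 2)
  rw [div_le_iff₀ hδ] at hL
  rw [div_lt_iff₀ hδ] at hK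
  have hLk : ∀ (k : ℕ), max ‖N₁‖ ‖N₂‖ ≤ 2 ^ k * δ * L := by
    intro k
    refine hL.trans ?_
    rw [mul_comm, mul_assoc]
    exact le_mul_of_one_le_left (by positivity) (one_le_pow₀ one_le_two)
  set D : ℕ → H →L[ℂ] H := fun k =>
    cfc (discretize f L (2 ^ k * δ)) N₁ - cfc (discretize f L (2 ^ k * δ)) N₂ with hD
  have hD0 : ∀ N : H →L[ℂ] H, ‖N‖ ≤ max ‖N₁‖ ‖N₂‖ →
      ‖cfc f N - cfc (discretize f L (2 ^ 0 * δ)) N‖ ≤ M * δ ^ α := by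
    intro N hN
    by_cases hNn : IsStarNormal N
    · rw [pow_zero, one_mul, ← cfc_sub _ _ N hfc.continuousOn
        (continuous_discretize f L δ).continuousOn]
      refine norm_cfc_le (by positivity) fun z hz => norm_sub_discretize_le hα hM hf hδ ?_
      exact norm_inv_smul_le_of_mem_spectrum hz hδ (hN.trans (by linarith))
    · rw [cfc_apply_of_not_predicate _ hNn, cfc_apply_of_not_predicate _ hNn, sub_zero, norm_zero]
      positivity
  have hDK : D K = 0 := by
    have : ∀ N : H →L[ℂ] H, IsStarNormal N → ‖N‖ ≤ max ‖N₁‖ ‖N₂‖ →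
        cfc (discretize f L (2 ^ K * δ)) N = cfc (fun _ => f 0) N := by
      intro N _ hN
      refine cfc_congr fun z hz => discretize_eq_of_norm_le ?_ ?_
      · exact norm_inv_smul_le_of_mem_spectrum hz (by positivity) (hN.trans (hLk K))
      · exact norm_inv_smul_le_of_mem_spectrum hz (by positivity) (hN.trans (by linarith))
    simp only [hD]
    rw [this N₁ h₁ (le_max_left _ _), this N₂ h₂ (le_max_right _ _), cfc_const _ _ h₁,
      cfc_const _ _ h₂, sub_self]
  have hstep : ∀ k ∈ Finset.range K, TraceNormLE (D k - D (k + 1))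
      (A * (M * C * δ ^ (α - 1)) * ((2 : ℝ) ^ (α - 1)) ^ k) := by
    intro k _
    have h3 := TraceNormLE.cfc_discretize_sub hφ hi hi' hθ hα hα1 hM hf h₁ h₂ h
      (l := 2 ^ k * δ) (by positivity) ((le_max_left _ _).trans (hLk k))
      ((le_max_right _ _).trans (hLk k))
    rw [← mul_assoc 2, ← pow_succ'] at h3
    refine h3.mono (le_of_eq ?_)
    rw [Real.mul_rpow (by positivity) hδ.le, ← Real.rpow_natCast_mul (by norm_num),
      ← Real.rpow_mul_natCast (by norm_num), mul_comm (k : ℝ)]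
    ring
  have hq0 : (0 : ℝ) ≤ 2 ^ (α - 1) := by positivity
  have hq1 : (2 : ℝ) ^ (α - 1) < 1 := Real.rpow_lt_one_of_one_lt_of_neg one_lt_two (by linarith)
  have hDt : TraceNormLE (D 0) (A * (M * C * δ ^ (α - 1)) * (1 - 2 ^ (α - 1))⁻¹) := by
    have h3 := TraceNormLE.sum _ hstep
    rw [Finset.sum_range_sub', hDK, sub_zero, ← Finset.mul_sum] at h3
    refine h3.mono ?_
    gcongr
    rw [← tsum_geometric_of_lt_one hq0 hq1]
    exact (summable_geometric_of_lt_one hq0 hq1).sum_le_tsum _ fun _ _ => by positivity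
  have hsplit : cfc f N₁ - cfc f N₂ = ((cfc f N₁ - cfc (discretize f L (2 ^ 0 * δ)) N₁) -
      (cfc f N₂ - cfc (discretize f L (2 ^ 0 * δ)) N₂)) + D 0 := by
    simp only [hD]
    abel
  rw [hsplit]
  refine (sNum_add_le _ _ _).trans (add_le_add ?_ (hDt.sNum_le j))
  refine (norm_sub_le _ _).trans ?_
  have := hD0 N₁ (le_max_left _ _)
  have := hD0 N₂ (le_max_right _ _)
  linarith

end HolderEstimate

/-- Let `0 < α < 1`. There is `c > 0` (depending only on `α`) such that for every
`f ∈ Λ_α(ℝ²)` with Hölder bound `M` (so `‖f‖_{Λ_α} ≤ M`) and all bounded normal operators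
`N₁, N₂` with `N₁ - N₂ ∈ S₁`, the singular values of `f(N₁) - f(N₂)` satisfy
`s_j(f(N₁) - f(N₂)) ≤ c M (1+j)^{-α} ‖N₁ - N₂‖_{S₁}^α` for all `j ≥ 0`;
in particular `f(N₁) - f(N₂) ∈ S_{1/α,∞}`. -/
theorem holder_trace_class_weak :
    ∀ (α : ℝ), 0 < α → α < 1 →
    ∃ c : ℝ, 0 < c ∧
      ∀ (f : ℂ → ℂ) (M : ℝ), 0 ≤ M →
      (∀ z₁ z₂ : ℂ, ‖f z₁ - f z₂‖ ≤ M * ‖z₁ - z₂‖ ^ α) →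
      ∀ (H : Type*) [NormedAddCommGroup H] [InnerProductSpace ℂ H] [CompleteSpace H]
        (N₁ N₂ : H →L[ℂ] H), IsStarNormal N₁ → IsStarNormal N₂ →
        MemTraceClass (N₁ - N₂) →
        ∀ j : ℕ, sNum (cfc f N₁ - cfc f N₂) j ≤
          c * M * ((1 : ℝ) + j) ^ (-α) * (∑' i : ℕ, sNum (N₁ - N₂) i) ^ α := by
  intro α hα hα1
  obtain ⟨φ, hφ, hi, hi', hθ⟩ := hasCompactSupport_bump.exists_eq_integral_phase contDiff_bump
  set A : ℝ := 54 * Real.pi * (∫ w, ‖w‖ * ‖φ w‖) * (1 - 2 ^ (α - 1))⁻¹ with hA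
  have hq1 : (2 : ℝ) ^ (α - 1) < 1 := Real.rpow_lt_one_of_one_lt_of_neg one_lt_two (by linarith)
  have hA0 : 0 ≤ A := mul_nonneg (mul_nonneg (by positivity)
    (MeasureTheory.integral_nonneg fun w => by positivity)) (inv_nonneg.2 (by linarith))
  refine ⟨(2 + A) * 24 ^ α, by positivity, ?_⟩
  intro f M hM hf H _ _ _ N₁ N₂ h₁ h₂ hD j
  set T : ℝ := ∑' i : ℕ, sNum (N₁ - N₂) i with hT
  have hT0 : 0 ≤ T := tsum_nonneg fun i => sNum_nonneg _ _
  have htr := hD.traceNormLE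
  have hbound : ∀ ε : ℝ, 0 < ε → sNum (cfc f N₁ - cfc f N₂) j ≤
      (2 + A) * (M * (2 * (12 * T + ε) / (j + 1)) ^ α) := by
    intro ε hε
    have hC : 0 < 12 * T + ε := by positivity
    have hk : ((j : ℝ) + 1) / 2 ≤ (j / 2 : ℕ) + 1 := by
      have : j + 1 ≤ 2 * (j / 2 + 1) := by omega
      have : (j : ℝ) + 1 ≤ 2 * ((j / 2 : ℕ) + 1) := by exact_mod_cast this
      linarith
    have hδ : 0 < (12 * T + ε) / ((j / 2 : ℕ) + 1) := by positivity
    have h := sNum_cfc_sub_le hφ hi hi' hθ hα hα1 hM hf h₁ h₂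
      (htr.mono (show 12 * T ≤ 12 * T + ε by linarith)) hδ (j / 2)
    have hδ' : (12 * T + ε) / ((j / 2 : ℕ) + 1) ≤ 2 * (12 * T + ε) / (j + 1) := by
      rw [div_le_div_iff₀ (by positivity) (by positivity)]
      nlinarith
    calc sNum (cfc f N₁ - cfc f N₂) j
        ≤ sNum (cfc f N₁ - cfc f N₂) (2 * (j / 2)) := sNum_antitone _ (Nat.mul_div_le j 2)
      _ ≤ (2 + A) * (M * ((12 * T + ε) / ((j / 2 : ℕ) + 1)) ^ α) := by
          refine h.trans (le_of_eq ?_)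
          rw [Real.rpow_sub_one hδ.ne', hA]
          field_simp
      _ ≤ _ := by gcongr
  have hlim : Filter.Tendsto (fun ε : ℝ => (2 + A) * (M * (2 * (12 * T + ε) / (j + 1)) ^ α))
      (nhdsWithin 0 (Set.Ioi 0)) (nhds ((2 + A) * (M * (2 * (12 * T + 0) / (j + 1)) ^ α))) := by
    refine Filter.Tendsto.mono_left (Continuous.tendsto ?_ 0) nhdsWithin_le_nhds
    have : Continuous fun ε : ℝ => 2 * (12 * T + ε) / ((j : ℝ) + 1) := by fun_prop
    exact ((this.rpow_const fun _ => Or.inr hα.le).const_mul M).const_mul (2 + A)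
  have hle := ge_of_tendsto hlim (Filter.eventually_of_mem self_mem_nhdsWithin hbound)
  refine hle.trans (le_of_eq ?_)
  have h24 : 2 * (12 * T + 0) / ((j : ℝ) + 1) = 24 * T * (1 + (j : ℝ))⁻¹ := by
    rw [div_eq_mul_inv, add_comm (j : ℝ)]
    ring
  rw [h24, Real.mul_rpow (by positivity) (by positivity), Real.mul_rpow (by norm_num) hT0,
    Real.inv_rpow (by positivity), Real.rpow_neg (by positivity)]
  ring
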